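/- arXiv:2011.02020 — 4 statements merged into one kernel-verified Lean document; each statement's English description precedes it below -/
import Mathlib

section
/- Fix an integer budget Γ with 1 ≤ Γ ≤ |J|. For every vector x : V → ℝ with x_i ≥ 0 for all i ∈ V, the following are equivalent: (i) x is a schedule of (V,A,p+δ) for every δ in the budgeted uncertainty set Δ with budget Γ; (ii) x is a schedule of (V,A,p+δ̂); (iii) x is a schedule of (V,A,p+δ) for every δ : V → ℝ with 0 ≤ δ_i ≤ δ̂_i for all i ∈ V (box uncertainty). In particular, for every budget Γ ≥ 1, the vectors satisfying all precedence constraints robustly over the budgeted uncertainty set coincide with those satisfying them robustly over the box uncertainty set Π_{i∈J}[0, δ̂_i]. -/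
/-- `x` is a schedule of the precedence graph `(V, E, p)`:
nonnegative starting times satisfying `x j - x i ≥ p i` for every arc `(i,j) ∈ E`. -/
def Schedule {V : Type*} (E : Set (V × V)) (p : V → ℝ) (x : V → ℝ) : Prop :=
  (∀ i, 0 ≤ x i) ∧ ∀ i j : V, (i, j) ∈ E → p i ≤ x j - x i

/-- `δ` belongs to the budgeted uncertainty set with deviations `δhat` and budget `Γ`:
there is `S ⊆ J` with `|S| ≤ Γ` such that `δ` equals `δhat` on `S` and `0` elsewhere. -/
def InBudget {V : Type*} [DecidableEq V] (J : Finset V) (δhat : V → ℝ) (Γ : ℕ)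
    (δ : V → ℝ) : Prop :=
  ∃ S : Finset V, S ⊆ J ∧ S.card ≤ Γ ∧ (∀ i ∈ S, δ i = δhat i) ∧ ∀ i, i ∉ S → δ i = 0

theorem Schedule.mono {V : Type*} {E : Set (V × V)} {p q x : V → ℝ}
    (h : Schedule E q x) (hpq : ∀ i, p i ≤ q i) : Schedule E p x :=
  ⟨h.1, fun i j hij => (hpq i).trans (h.2 i j hij)⟩

/-- Every element of the budgeted uncertainty set lies in the box `Π_i [0, δhat i]`. -/
theorem InBudget.mem_box {V : Type*} [DecidableEq V] {J : Finset V} {δhat δ : V → ℝ}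
    {Γ : ℕ} (h : InBudget J δhat Γ δ) (hδhat : ∀ i, 0 ≤ δhat i) (i : V) :
    0 ≤ δ i ∧ δ i ≤ δhat i := by
  obtain ⟨S, -, -, hS, hS'⟩ := h
  by_cases hi : i ∈ S
  · simp [hS i hi, hδhat i]
  · simp [hS' i hi, hδhat i]

/-- With positive budget, each single deviation is attained in the budgeted set. -/
theorem InBudget.exists_apply_eq {V : Type*} [DecidableEq V] {J : Finset V} {δhat : V → ℝ}
    {Γ : ℕ} (hΓ : 1 ≤ Γ) (hJ : ∀ i, i ∉ J → δhat i = 0) (i : V) :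
    ∃ δ, InBudget J δhat Γ δ ∧ δ i = δhat i := by
  by_cases hi : i ∈ J
  · refine ⟨Pi.single i (δhat i), ⟨{i}, by simpa using hi, by simpa using hΓ, ?_, ?_⟩, by simp⟩
    · simp
    · intro j hj
      exact Pi.single_eq_of_ne (by simpa using hj) _
  · exact ⟨0, ⟨∅, by simp, by simp, by simp, by simp⟩, (hJ i hi).symm⟩

/-- For a budget `1 ≤ Γ ≤ |J|`, a nonnegative vector `x` satisfies all precedence
constraints robustly over the budgeted uncertainty set iff it is a schedule for the
worst-case processing times `p + δhat`, iff it satisfies them robustly over the box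
uncertainty set `Π_{i} [0, δhat i]`. -/
theorem static_robust_budget_eq_box {V : Type*} [Fintype V] [DecidableEq V]
    (J : Finset V) (s t : V) (hst : s ≠ t) (hsJ : s ∉ J) (htJ : t ∉ J)
    (hV : ∀ v : V, v ∈ J ∨ v = s ∨ v = t)
    (A : Set (V × V))
    (p : V → ℝ) (hp : ∀ i, 0 ≤ p i) (hps : p s = 0) (hpt : p t = 0)
    (δhat : V → ℝ) (hδhat : ∀ i, 0 ≤ δhat i) (hδs : δhat s = 0) (hδt : δhat t = 0)
    (Γ : ℕ) (hΓ1 : 1 ≤ Γ) (hΓJ : Γ ≤ J.card)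
    (x : V → ℝ) (hx : ∀ i, 0 ≤ x i) :
    ((∀ δ : V → ℝ, InBudget J δhat Γ δ → Schedule A (fun i => p i + δ i) x) ↔
        Schedule A (fun i => p i + δhat i) x) ∧
    (Schedule A (fun i => p i + δhat i) x ↔
        ∀ δ : V → ℝ, (∀ i, 0 ≤ δ i ∧ δ i ≤ δhat i) →
          Schedule A (fun i => p i + δ i) x) := by
  have hJ : ∀ i, i ∉ J → δhat i = 0 := by
    intro i hi
    rcases hV i with h | rfl | rfl
    · exact absurd h hi
    · exact hδs
    · exact hδt
  refine ⟨⟨fun h => ⟨hx, fun i j hij => ?_⟩, fun h δ hδ => ?_⟩, fun h δ hδ => ?_, fun h => ?_⟩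
  · obtain ⟨δ, hδ, hδi⟩ := InBudget.exists_apply_eq hΓ1 hJ i
    simpa only [hδi] using (h δ hδ).2 i j hij
  · exact h.mono fun i => add_le_add_right (hδ.mem_box hδhat i).2 (p i)
  · exact h.mono fun i => add_le_add_right (hδ i).2 (p i)
  · exact h δhat fun i => ⟨hδhat i, le_rfl⟩
end

section
/- Let E be an arc set with (V,E) acyclic. Then the worst-case makespan Q_Γ(E) equals the minimum of x^Γ_t over all layered schedules x of G^lay(E, {t}), and this minimum is attained. -/
/-- `(α, E)` is acyclic: there is no closed walk of positive length along arcs of `E`. -/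
def Acyclic {α : Type*} (E : Set (α × α)) : Prop :=
  ¬ ∃ (m : ℕ) (v : ℕ → α), 1 ≤ m ∧ v 0 = v m ∧ ∀ ℓ < m, (v ℓ, v (ℓ + 1)) ∈ E

/-- Layered schedule of the layered graph `G^lay(E, H)` with `Γ+1` layers. -/
def LayeredSchedule {V : Type*} (E : Set (V × V)) (H : Set V) (p δhat : V → ℝ) (Γ : ℕ)
    (x : ℕ → V → ℝ) : Prop :=
  (∀ γ ≤ Γ, ∀ i, 0 ≤ x γ i) ∧
  (∀ γ ≤ Γ, ∀ i j : V, (i, j) ∈ E → p i ≤ x γ j - x γ i) ∧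
  (∀ γ < Γ, ∀ i j : V, (i, j) ∈ E → p i + δhat i ≤ x γ j - x (γ + 1) i) ∧
  ∀ j ∈ H, ∀ γ < Γ, 0 ≤ x Γ j - x γ j

/-- The set of makespans `x t` of schedules of `(V, E, p)`. -/
def MakespanSet {V : Type*} (E : Set (V × V)) (p : V → ℝ) (t : V) : Set ℝ :=
  { c | ∃ x : V → ℝ, Schedule E p x ∧ x t = c }

/-- The set of inner minima `min { x t : x schedule of (V,E,p+δ) }` over budgeted `δ`;
the worst-case makespan `Q_Γ(E)` is its greatest element. -/
def WorstCaseSet {V : Type*} [DecidableEq V] (J : Finset V) (δhat : V → ℝ) (Γ : ℕ)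
    (E : Set (V × V)) (p : V → ℝ) (t : V) : Set ℝ :=
  { m | ∃ δ : V → ℝ, InBudget J δhat Γ δ ∧
      IsLeast (MakespanSet E (fun i => p i + δ i) t) m }

/-- `Precedes E i j` holds when there is a walk of positive length from `i` to `j` along `E`. -/
def Precedes {V : Type*} (E : Set (V × V)) : V → V → Prop :=
  Relation.TransGen fun a b => (a, b) ∈ E

theorem Precedes.exists_walk {V : Type*} {E : Set (V × V)} {a b : V} (h : Precedes E a b) :
    ∃ (m : ℕ) (v : ℕ → V), 1 ≤ m ∧ v 0 = a ∧ v m = b ∧ ∀ ℓ < m, (v ℓ, v (ℓ + 1)) ∈ E := by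
  induction h with
  | @single b h =>
    refine ⟨1, fun n => if n = 0 then a else b, le_rfl, by simp, by simp, fun ℓ hℓ => ?_⟩
    obtain rfl : ℓ = 0 := by omega
    simpa using h
  | @tail b c _ hbc ih =>
    obtain ⟨m, v, hm, h0, hb, hv⟩ := ih
    refine ⟨m + 1, fun n => if n ≤ m then v n else c, by omega, by simpa using h0, by simp,
      fun ℓ hℓ => ?_⟩
    rcases Nat.lt_succ_iff_lt_or_eq.mp hℓ with h | rfl
    · simpa [h.le, Nat.succ_le_of_lt h] using hv ℓ h
    · simpa [hb] using hbc

theorem Acyclic.not_precedes_self {V : Type*} {E : Set (V × V)} (hE : Acyclic E) (i : V) :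
    ¬ Precedes E i i := fun h => by
  obtain ⟨m, v, hm, h0, hb, hv⟩ := h.exists_walk
  exact hE ⟨m, v, hm, h0.trans hb.symm, hv⟩

open Classical in
/-- The set of strict predecessors of `i`. -/
noncomputable def predecessors {V : Type*} [Fintype V] (E : Set (V × V)) (i : V) : Finset V :=
  Finset.univ.filter fun k => Precedes E k i

theorem mem_predecessors {V : Type*} [Fintype V] {E : Set (V × V)} {i k : V} :
    k ∈ predecessors E i ↔ Precedes E k i := by
  simp [predecessors]

theorem insert_predecessors_subset {V : Type*} [Fintype V] [DecidableEq V] {E : Set (V × V)}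
    {i j : V} (h : (i, j) ∈ E) : insert i (predecessors E i) ⊆ predecessors E j := by
  intro k hk
  rcases Finset.mem_insert.mp hk with rfl | hk
  · exact mem_predecessors.mpr (.single h)
  · exact mem_predecessors.mpr (.tail (mem_predecessors.mp hk) h)

theorem Acyclic.exists_schedule {V : Type*} [Fintype V] [DecidableEq V] {E : Set (V × V)}
    (hE : Acyclic E) {q : V → ℝ} (hq : ∀ i, 0 ≤ q i) : ∃ x, Schedule E q x := by
  refine ⟨fun i => ∑ k ∈ predecessors E i, q k,
    fun i => Finset.sum_nonneg fun k _ => hq k, fun i j hij => ?_⟩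
  have h := Finset.sum_le_sum_of_subset_of_nonneg (f := q) (insert_predecessors_subset hij)
    fun k _ _ => hq k
  rw [Finset.sum_insert (fun h => hE.not_precedes_self i (mem_predecessors.mp h))] at h
  linarith

/-- The earliest start time of `i` among all schedules of `(V, E, q)`. -/
noncomputable def earliestStart {V : Type*} (E : Set (V × V)) (q : V → ℝ) (i : V) : ℝ :=
  sInf (MakespanSet E q i)

theorem Schedule.earliestStart_le {V : Type*} {E : Set (V × V)} {q x : V → ℝ}
    (hx : Schedule E q x) (i : V) : earliestStart E q i ≤ x i :=
  csInf_le ⟨0, by rintro _ ⟨y, hy, rfl⟩; exact hy.1 i⟩ ⟨x, hx, rfl⟩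

theorem Acyclic.schedule_earliestStart {V : Type*} [Fintype V] [DecidableEq V]
    {E : Set (V × V)} (hE : Acyclic E) {q : V → ℝ} (hq : ∀ i, 0 ≤ q i) :
    Schedule E q (earliestStart E q) := by
  obtain ⟨x, hx⟩ := hE.exists_schedule hq
  refine ⟨fun i => le_csInf ⟨x i, x, hx, rfl⟩ ?_, fun i j hij => ?_⟩
  · rintro _ ⟨y, hy, rfl⟩
    exact hy.1 i
  · have h : earliestStart E q i + q i ≤ earliestStart E q j := by
      refine le_csInf ⟨x j, x, hx, rfl⟩ ?_
      rintro _ ⟨y, hy, rfl⟩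
      linarith [hy.2 i j hij, hy.earliestStart_le i]
    linarith

theorem Acyclic.isLeast_earliestStart {V : Type*} [Fintype V] [DecidableEq V]
    {E : Set (V × V)} (hE : Acyclic E) {q : V → ℝ} (hq : ∀ i, 0 ≤ q i) (i : V) :
    IsLeast (MakespanSet E q i) (earliestStart E q i) :=
  ⟨⟨_, hE.schedule_earliestStart hq, rfl⟩, by
    rintro _ ⟨y, hy, rfl⟩
    exact hy.earliestStart_le i⟩

theorem Acyclic.earliestStart_mono {V : Type*} [Fintype V] [DecidableEq V]
    {E : Set (V × V)} (hE : Acyclic E) {q r : V → ℝ} (hr : ∀ i, 0 ≤ r i)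
    (hqr : ∀ i, q i ≤ r i) (i : V) : earliestStart E q i ≤ earliestStart E r i :=
  Schedule.earliestStart_le
    ⟨(hE.schedule_earliestStart hr).1,
      fun a b hab => (hqr a).trans ((hE.schedule_earliestStart hr).2 a b hab)⟩ i

/-- The processing times when exactly the jobs in `S` deviate. -/
def deviated {V : Type*} [DecidableEq V] (p δhat : V → ℝ) (S : Finset V) (i : V) : ℝ :=
  p i + if i ∈ S then δhat i else 0

theorem deviated_mono {V : Type*} [DecidableEq V] {p δhat : V → ℝ} (hδ : ∀ i, 0 ≤ δhat i)
    {S T : Finset V} (hST : S ⊆ T) (i : V) : deviated p δhat S i ≤ deviated p δhat T i := by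
  unfold deviated
  by_cases hS : i ∈ S
  · simp [hS, hST hS]
  · by_cases hT : i ∈ T <;> simp [hS, hT, hδ i]

theorem deviated_nonneg {V : Type*} [DecidableEq V] {p δhat : V → ℝ} (hp : ∀ i, 0 ≤ p i)
    (hδ : ∀ i, 0 ≤ δhat i) (S : Finset V) (i : V) : 0 ≤ deviated p δhat S i := by
  have := hp i
  have := hδ i
  unfold deviated
  split_ifs <;> linarith

theorem deviated_le {V : Type*} [DecidableEq V] {p δhat : V → ℝ} (hδ : ∀ i, 0 ≤ δhat i)
    (S : Finset V) (i : V) : deviated p δhat S i ≤ p i + δhat i := by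
  have := hδ i
  unfold deviated
  split_ifs <;> linarith

/-- The largest earliest start time of `i` when at most `k` jobs of `J` deviate. -/
noncomputable def worstStart {V : Type*} [DecidableEq V] (J : Finset V) (E : Set (V × V))
    (p δhat : V → ℝ) (k : ℕ) (i : V) : ℝ :=
  (J.powerset.filter fun S => S.card ≤ k).sup' ⟨∅, by simp⟩
    fun S => earliestStart E (deviated p δhat S) i

theorem earliestStart_le_worstStart {V : Type*} [DecidableEq V] {J : Finset V}
    {E : Set (V × V)} {p δhat : V → ℝ} {k : ℕ} {S : Finset V} (hS : S ⊆ J) (hk : S.card ≤ k)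
    (i : V) : earliestStart E (deviated p δhat S) i ≤ worstStart J E p δhat k i :=
  Finset.le_sup' (fun S => earliestStart E (deviated p δhat S) i) (by simp [hS, hk])

theorem worstStart_le {V : Type*} [DecidableEq V] {J : Finset V}
    {E : Set (V × V)} {p δhat : V → ℝ} {k : ℕ} {i : V} {c : ℝ}
    (h : ∀ S ⊆ J, S.card ≤ k → earliestStart E (deviated p δhat S) i ≤ c) :
    worstStart J E p δhat k i ≤ c :=
  Finset.sup'_le _ _ fun S hS => by
    simp only [Finset.mem_filter, Finset.mem_powerset] at hS
    exact h S hS.1 hS.2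

theorem worstStart_mono {V : Type*} [DecidableEq V] {J : Finset V}
    {E : Set (V × V)} {p δhat : V → ℝ} {k l : ℕ} (hkl : k ≤ l) (i : V) :
    worstStart J E p δhat k i ≤ worstStart J E p δhat l i :=
  worstStart_le fun _ hS hk => earliestStart_le_worstStart hS (hk.trans hkl) i

section WorstStart

variable {V : Type*} [Fintype V] [DecidableEq V] {J : Finset V} {E : Set (V × V)}
  {p δhat : V → ℝ}

theorem worstStart_nonneg (hE : Acyclic E) (hp : ∀ i, 0 ≤ p i) (hδ : ∀ i, 0 ≤ δhat i)
    (k : ℕ) (i : V) : 0 ≤ worstStart J E p δhat k i :=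
  ((hE.schedule_earliestStart (deviated_nonneg hp hδ ∅)).1 i).trans
    (earliestStart_le_worstStart (Finset.empty_subset J) (by simp) i)

theorem worstStart_add_le (hE : Acyclic E) (hp : ∀ i, 0 ≤ p i) (hδ : ∀ i, 0 ≤ δhat i)
    (k : ℕ) {i j : V} (hij : (i, j) ∈ E) :
    worstStart J E p δhat k i + p i ≤ worstStart J E p δhat k j := by
  rw [← le_sub_iff_add_le]
  refine worstStart_le fun S hS hk => ?_
  have h := (hE.schedule_earliestStart (deviated_nonneg hp hδ S)).2 i j hij
  have h' := earliestStart_le_worstStart (E := E) (p := p) (δhat := δhat) hS hk j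
  have h'' : p i ≤ deviated p δhat S i := by
    have := hδ i
    unfold deviated
    split_ifs <;> linarith
  linarith

theorem worstStart_add_deviation_le (hE : Acyclic E) (hp : ∀ i, 0 ≤ p i)
    (hδ : ∀ i, 0 ≤ δhat i) (hJ : ∀ i ∉ J, δhat i = 0) (k : ℕ) {i j : V} (hij : (i, j) ∈ E) :
    worstStart J E p δhat k i + (p i + δhat i) ≤ worstStart J E p δhat (k + 1) j := by
  by_cases hi : i ∈ J
  · rw [← le_sub_iff_add_le]
    refine worstStart_le fun S hS hk => ?_
    have hr := deviated_nonneg hp hδ (insert i S)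
    have h := (hE.schedule_earliestStart hr).2 i j hij
    have hm := hE.earliestStart_mono hr (deviated_mono hδ (Finset.subset_insert i S)) i
    have h' := earliestStart_le_worstStart (E := E) (p := p) (δhat := δhat)
      (Finset.insert_subset hi hS)
      ((Finset.card_insert_le i S).trans (Nat.add_le_add_right hk 1)) j
    have hd : deviated p δhat (insert i S) i = p i + δhat i := by simp [deviated]
    linarith
  · rw [hJ i hi, add_zero]
    exact (worstStart_add_le hE hp hδ k hij).trans (worstStart_mono k.le_succ j)

theorem worstStart_le_earliestStart (hE : Acyclic E) (hp : ∀ i, 0 ≤ p i)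
    (hδ : ∀ i, 0 ≤ δhat i) (k : ℕ) (i : V) :
    worstStart J E p δhat k i ≤ earliestStart E (fun i => p i + δhat i) i :=
  worstStart_le fun S _ _ =>
    hE.earliestStart_mono (fun i => add_nonneg (hp i) (hδ i)) (deviated_le hδ S) i

theorem worstStart_eq_of_isGreatest (hE : Acyclic E) (hp : ∀ i, 0 ≤ p i)
    (hδ : ∀ i, 0 ≤ δhat i) {Γ : ℕ} {t : V} {Q : ℝ}
    (hQ : IsGreatest (WorstCaseSet J δhat Γ E p t) Q) :
    worstStart J E p δhat Γ t = Q := by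
  refine le_antisymm (worstStart_le fun S hS hk => hQ.2 ?_) ?_
  · exact ⟨fun i => if i ∈ S then δhat i else 0,
      ⟨S, hS, hk, fun i hi => if_pos hi, fun i hi => if_neg hi⟩,
      hE.isLeast_earliestStart (deviated_nonneg hp hδ S) t⟩
  · obtain ⟨δ, ⟨S, hS, hk, h1, h0⟩, hleast⟩ := hQ.1
    have hd : (fun i => p i + δ i) = deviated p δhat S := by
      funext i
      by_cases hi : i ∈ S <;> simp [deviated, hi, h1, h0]
    rw [hd] at hleast
    rw [hleast.unique (hE.isLeast_earliestStart (deviated_nonneg hp hδ S) t)]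
    exact earliestStart_le_worstStart hS hk t

/-- A layered schedule whose makespan is the worst-case start time of `t`. -/
theorem exists_layeredSchedule (hE : Acyclic E) (hp : ∀ i, 0 ≤ p i) (hδ : ∀ i, 0 ≤ δhat i)
    (hJ : ∀ i ∉ J, δhat i = 0) (Γ : ℕ) (t : V) :
    ∃ x, LayeredSchedule E {t} p δhat Γ x ∧ x Γ t = worstStart J E p δhat Γ t := by
  classical
  set L := earliestStart E fun i => p i + δhat i
  have hL : Schedule E (fun i => p i + δhat i) L :=
    hE.schedule_earliestStart fun i => add_nonneg (hp i) (hδ i)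
  set Q := worstStart J E p δhat Γ t
  have hQ0 : 0 ≤ Q := worstStart_nonneg hE hp hδ Γ t
  let x : ℕ → V → ℝ := fun γ i =>
    if Precedes E t i then Q + L i else if i = t then Q else worstStart J E p δhat (Γ - γ) i
  have hxt (γ : ℕ) : x γ t = Q := by simp [x, hE.not_precedes_self t]
  have hdesc {γ : ℕ} {i : V} (h : Precedes E t i) : x γ i = Q + L i := by simp [x, h]
  have hother {γ : ℕ} {i : V} (h : ¬ Precedes E t i) (hi : i ≠ t) :
      x γ i = worstStart J E p δhat (Γ - γ) i := by simp [x, h, hi]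
  have hstep {γ γ' : ℕ} {i j : V} (hij : (i, j) ∈ E) {c : ℝ} (hc : c ≤ p i + δhat i)
      (hγ : worstStart J E p δhat (Γ - γ') i + c ≤ worstStart J E p δhat (Γ - γ) j) :
      c ≤ x γ j - x γ' i := by
    have hLij := hL.2 i j hij
    by_cases hi : Precedes E t i
    · rw [hdesc hi, hdesc (.tail hi hij)]
      linarith
    by_cases hit : i = t
    · subst hit
      rw [hxt, hdesc (.single hij)]
      linarith [hL.1 i]
    rw [hother hi hit]
    by_cases hj : Precedes E t j
    · rw [hdesc hj]
      linarith [worstStart_le_earliestStart (J := J) hE hp hδ (Γ - γ') i]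
    by_cases hjt : j = t
    · subst hjt
      rw [hxt]
      linarith [worstStart_mono (J := J) (E := E) (p := p) (δhat := δhat) (Nat.sub_le Γ γ) j]
    rw [hother hj hjt]
    linarith
  refine ⟨x, ⟨fun γ _ i => ?_, fun γ _ i j hij => ?_, fun γ hγ i j hij => ?_, ?_⟩, hxt Γ⟩
  · by_cases hi : Precedes E t i
    · rw [hdesc hi]
      exact add_nonneg hQ0 (hL.1 i)
    by_cases hit : i = t
    · rwa [hit, hxt]
    rw [hother hi hit]
    exact worstStart_nonneg hE hp hδ _ i
  · exact hstep hij (le_add_of_nonneg_right (hδ i)) (worstStart_add_le hE hp hδ _ hij)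
  · refine hstep hij le_rfl ?_
    rw [show Γ - γ = Γ - (γ + 1) + 1 by omega]
    exact worstStart_add_deviation_le hE hp hδ hJ _ hij
  · rintro _ rfl γ _
    rw [hxt, hxt, sub_self]

/-- Every layered schedule dominates the earliest start time of `t` under any scenario. -/
theorem earliestStart_le_of_layeredSchedule (hE : Acyclic E) {Γ : ℕ} {t : V} {S : Finset V}
    (hk : S.card ≤ Γ) {x : ℕ → V → ℝ} (hx : LayeredSchedule E {t} p δhat Γ x) :
    earliestStart E (deviated p δhat S) t ≤ x Γ t := by
  obtain ⟨hnonneg, hhor, htrans, hvert⟩ := hx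
  let a : V → ℕ := fun i => (S ∩ predecessors E i).card
  have ha (i : V) : a i ≤ Γ := (Finset.card_le_card Finset.inter_subset_left).trans hk
  have hne (i : V) : (Finset.Icc (Γ - a i) Γ).Nonempty := ⟨Γ, by simp⟩
  let w : V → ℝ := fun i => (Finset.Icc (Γ - a i) Γ).sup' (hne i) fun γ => x γ i
  have hw {i : V} {γ : ℕ} (h : Γ - a i ≤ γ) (h' : γ ≤ Γ) : x γ i ≤ w i :=
    Finset.le_sup' (fun γ => x γ i) (Finset.mem_Icc.mpr ⟨h, h'⟩)
  have hsched : Schedule E (deviated p δhat S) w := by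
    refine ⟨fun i => (hnonneg Γ le_rfl i).trans (hw (Nat.sub_le _ _) le_rfl), fun i j hij => ?_⟩
    suffices h : w i ≤ w j - deviated p δhat S i by linarith
    refine Finset.sup'_le _ _ fun γ hγ => ?_
    obtain ⟨hγ1, hγ2⟩ := Finset.mem_Icc.mp hγ
    have hsub := insert_predecessors_subset hij
    by_cases hi : i ∈ S
    · have hcard : a i + 1 ≤ a j := by
        have hni : i ∉ S ∩ predecessors E i := fun h =>
          hE.not_precedes_self i (mem_predecessors.mp (Finset.mem_inter.mp h).2)
        rw [← Finset.card_insert_of_notMem hni]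
        exact Finset.card_le_card (Finset.insert_subset
          (Finset.mem_inter.mpr ⟨hi, hsub (Finset.mem_insert_self i _)⟩)
          (Finset.inter_subset_inter_left ((Finset.subset_insert _ _).trans hsub)))
      obtain ⟨γ, rfl⟩ : ∃ γ', γ = γ' + 1 := ⟨γ - 1, by have := ha j; omega⟩
      have h := htrans γ hγ2 i j hij
      have h' : x γ j ≤ w j := hw (by omega) (by omega)
      simp only [deviated, if_pos hi]
      linarith
    · have hcard : a i ≤ a j := Finset.card_le_card
        (Finset.inter_subset_inter_left ((Finset.subset_insert _ _).trans hsub))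
      have h := hhor γ hγ2 i j hij
      have h' : x γ j ≤ w j := hw (by omega) hγ2
      simp only [deviated, if_neg hi]
      linarith
  refine (hsched.earliestStart_le t).trans (Finset.sup'_le _ _ fun γ hγ => ?_)
  rcases (Finset.mem_Icc.mp hγ).2.lt_or_eq with h | rfl
  · linarith [hvert t rfl γ h]
  · exact le_rfl

end WorstStart

/-- For acyclic `(V, E)`, the worst-case makespan `Q_Γ(E)` equals the minimum of
`x^Γ_t` over all layered schedules `x` of `G^lay(E, {t})`, and this minimum is attained. -/
theorem worst_case_makespan_eq_min_layered {V : Type*} [Fintype V] [DecidableEq V]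
    (J : Finset V) (s t : V) (hst : s ≠ t) (hsJ : s ∉ J) (htJ : t ∉ J)
    (hV : ∀ v : V, v ∈ J ∨ v = s ∨ v = t)
    (p : V → ℝ) (hp : ∀ i, 0 ≤ p i) (hps : p s = 0) (hpt : p t = 0)
    (δhat : V → ℝ) (hδhat : ∀ i, 0 ≤ δhat i) (hδs : δhat s = 0) (hδt : δhat t = 0)
    (Γ : ℕ)
    (E : Set (V × V)) (hE : Acyclic E)
    (Q : ℝ) (hQ : IsGreatest (WorstCaseSet J δhat Γ E p t) Q) :
    IsLeast { c : ℝ | ∃ x : ℕ → V → ℝ,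
        LayeredSchedule E {t} p δhat Γ x ∧ x Γ t = c } Q := by
  have hJ : ∀ i ∉ J, δhat i = 0 := fun i hi => by
    rcases hV i with h | rfl | rfl
    exacts [absurd h hi, hδs, hδt]
  rw [← worstStart_eq_of_isGreatest hE hp hδhat hQ]
  refine ⟨exists_layeredSchedule hE hp hδhat hJ Γ t, ?_⟩
  rintro _ ⟨x, hx, rfl⟩
  exact worstStart_le fun S _ hk => earliestStart_le_of_layeredSchedule hE hk hx
end

section
/- Let E be an arc set with (V,E) acyclic, let Γ ∈ ℕ, and let H ⊆ V. Consider the directed graph on vertex set {0,…,Γ} × V whose arcs are: ((γ,i),(γ,j)) for all 0 ≤ γ ≤ Γ and (i,j) ∈ E (horizontal arcs); ((γ+1,i),(γ,j)) for all 0 ≤ γ < Γ and (i,j) ∈ E (transversal arcs); and ((γ,j),(Γ,j)) for all j ∈ H and 0 ≤ γ < Γ (vertical arcs). Then this layered graph is acyclic: there is no sequence of vertices w_0, w_1, …, w_m with m ≥ 1, w_0 = w_m, and each pair (w_ℓ, w_{ℓ+1}) one of the above arcs. -/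
/-- The arc set of the layered graph `G^lay(E, H)` with layers `0, …, Γ`:
horizontal arcs `((γ,i),(γ,j))`, transversal arcs `((γ+1,i),(γ,j))` for `(i,j) ∈ E`,
and vertical arcs `((γ,j),(Γ,j))` for `j ∈ H`, `γ < Γ`. -/
def LayArc {V : Type*} (E : Set (V × V)) (H : Set V) (Γ : ℕ) :
    Set ((ℕ × V) × (ℕ × V)) :=
  { a | (∃ γ ≤ Γ, ∃ i j : V, (i, j) ∈ E ∧ a = ((γ, i), (γ, j))) ∨
        (∃ γ < Γ, ∃ i j : V, (i, j) ∈ E ∧ a = ((γ + 1, i), (γ, j))) ∨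
        ∃ γ < Γ, ∃ j ∈ H, a = ((γ, j), (Γ, j)) }

theorem exists_walk_of_transGen {α : Type*} {E : Set (α × α)} {a b : α}
    (h : Relation.TransGen (fun x y => (x, y) ∈ E) a b) :
    ∃ (m : ℕ) (v : ℕ → α), 1 ≤ m ∧ v 0 = a ∧ v m = b ∧
      ∀ ℓ < m, (v ℓ, v (ℓ + 1)) ∈ E := by
  induction h using Relation.TransGen.head_induction_on with
  | @single c h =>
    refine ⟨1, fun n => Nat.casesOn n c fun _ => b, le_rfl, rfl, rfl, fun ℓ hℓ => ?_⟩
    obtain rfl : ℓ = 0 := by omega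
    exact h
  | @head c d h _ ih =>
    obtain ⟨m, v, _, h0, hb, hE⟩ := ih
    refine ⟨m + 1, fun n => Nat.casesOn n c v, by omega, rfl, hb, fun ℓ hℓ => ?_⟩
    cases ℓ with
    | zero => simpa [h0] using h
    | succ k => exact hE k (by omega)

theorem Acyclic.not_transGen_self {α : Type*} {E : Set (α × α)} (hE : Acyclic E) (a : α) :
    ¬ Relation.TransGen (fun x y => (x, y) ∈ E) a a := fun h =>
  let ⟨m, v, hm, h0, h1, hv⟩ := exists_walk_of_transGen h
  hE ⟨m, v, hm, h0.trans h1.symm, hv⟩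

/-- An arc set contained in a transitive irreflexive relation is acyclic. -/
theorem acyclic_of_forall_rel {α : Type*} {E : Set (α × α)} (R : α → α → Prop)
    (htrans : ∀ x y z, R x y → R y z → R x z) (hirrefl : ∀ x, ¬ R x x)
    (hER : ∀ x y, (x, y) ∈ E → R x y) : Acyclic E := by
  rintro ⟨m, v, hm, h0, hv⟩
  have key : ∀ n, 1 ≤ n → n ≤ m → R (v 0) (v n) := by
    intro n hn
    induction n, hn using Nat.le_induction with
    | base => exact fun h => hER _ _ (hv 0 (by omega))
    | succ n _ ih => exact fun h => htrans _ _ _ (ih (by omega)) (hER _ _ (hv n (by omega)))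
  have h := key m hm le_rfl
  rw [← h0] at h
  exact hirrefl _ h

/-- If `(V, E)` is acyclic then the layered graph `G^lay(E, H)` is acyclic. -/
theorem layered_graph_acyclic {V : Type*} [Fintype V] [DecidableEq V]
    (J : Finset V) (s t : V) (hst : s ≠ t) (hsJ : s ∉ J) (htJ : t ∉ J)
    (hV : ∀ v : V, v ∈ J ∨ v = s ∨ v = t)
    (E : Set (V × V)) (hE : Acyclic E) (Γ : ℕ) (H : Set V) :
    Acyclic (LayArc E H Γ) := by
  refine acyclic_of_forall_rel
    (fun x y => Relation.TransGen (fun i j => (i, j) ∈ E) x.2 y.2 ∨ x.2 = y.2 ∧ x.1 < y.1)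
    ?_ ?_ ?_
  · rintro ⟨a, i⟩ ⟨b, j⟩ ⟨c, k⟩ (h | ⟨rfl, h⟩) (h' | ⟨rfl, h'⟩)
    · exact .inl (h.trans h')
    · exact .inl h
    · exact .inl h'
    · exact .inr ⟨rfl, lt_trans h h'⟩
  · rintro x (h | ⟨-, h⟩)
    · exact hE.not_transGen_self _ h
    · exact lt_irrefl _ h
  · rintro x y (⟨γ, -, i, j, hij, h⟩ | ⟨γ, -, i, j, hij, h⟩ | ⟨γ, hγ, j, -, h⟩) <;>
      obtain ⟨rfl, rfl⟩ := Prod.mk.inj h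
    · exact .inl (.single hij)
    · exact .inl (.single hij)
    · exact .inr ⟨rfl, hγ⟩
end

section
/- Let E be an arc set with (V,E) acyclic and let M ∈ ℝ. Then there exists a schedule z of (V,E,p) with z_t ≤ M such that {t} is anchored with respect to z (for the budgeted uncertainty set Δ) if and only if M ≥ Q_Γ(E). -/
/-- `H` is anchored with respect to the schedule `z` for arc set `E` and the budgeted
uncertainty set. -/
def Anchored {V : Type*} [DecidableEq V] (J : Finset V) (δhat : V → ℝ) (Γ : ℕ)
    (E : Set (V × V)) (p : V → ℝ) (z : V → ℝ) (H : Set V) : Prop :=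
  ∀ δ : V → ℝ, InBudget J δhat Γ δ →
    ∃ zd : V → ℝ, Schedule E (fun i => p i + δ i) zd ∧ ∀ i ∈ H, zd i = z i

theorem Acyclic.wellFounded {V : Type*} [Finite V] {E : Set (V × V)} (hE : Acyclic E) :
    WellFounded fun i j => (i, j) ∈ E := by
  rw [wellFounded_iff_isEmpty_descending_chain]
  refine ⟨fun ⟨f, hf⟩ => ?_⟩
  obtain ⟨a, b, hne, hab⟩ := Finite.exists_ne_map_eq_of_infinite f
  wlog hlt : a < b generalizing a b
  · exact this b a hne.symm hab.symm (by omega)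
  refine hE ⟨b - a, fun ℓ => f (b - ℓ), by omega, ?_, fun ℓ hℓ => ?_⟩
  · simp only [Nat.sub_zero, Nat.sub_sub_self hlt.le, hab]
  · have h := hf (b - (ℓ + 1))
    rwa [show b - (ℓ + 1) + 1 = b - ℓ by omega] at h

/-- An acyclic precedence graph with nonnegative processing times has an earliest schedule. -/
theorem Acyclic.exists_earliest_schedule {V : Type*} [Finite V] {E : Set (V × V)}
    (hE : Acyclic E) {q : V → ℝ} (hq : ∀ i, 0 ≤ q i) :
    ∃ e : V → ℝ, Schedule E q e ∧ ∀ x, Schedule E q x → ∀ j, e j ≤ x j := by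
  have hwf := hE.wellFounded
  obtain ⟨e, he⟩ : ∃ e : V → ℝ, ∀ j, e j = ⨆ i : {i // (i, j) ∈ E}, (e i + q i) :=
    ⟨hwf.fix fun j rec => ⨆ i : {i // (i, j) ∈ E}, (rec i.1 i.2 + q i),
      fun j => hwf.fix_eq _ j⟩
  refine ⟨e, ⟨fun j => ?_, fun i j hij => ?_⟩, fun x hx j => ?_⟩
  · induction j using hwf.induction with
    | _ j ih =>
      rw [he]
      exact Real.iSup_nonneg fun i => add_nonneg (ih i i.2) (hq i)
  · have h : e i + q i ≤ e j := by
      rw [he j]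
      exact le_ciSup (f := fun i : {i // (i, j) ∈ E} => e i + q i)
        (Set.finite_range _).bddAbove ⟨i, hij⟩
    linarith
  · induction j using hwf.induction with
    | _ j ih =>
      rw [he]
      refine Real.iSup_le (fun i => ?_) (hx.1 j)
      linarith [ih i i.2, hx.2 i j i.2]

theorem Schedule.add_const {V : Type*} {E : Set (V × V)} {q x : V → ℝ} (hx : Schedule E q x)
    {c : ℝ} (hc : 0 ≤ c) : Schedule E q fun i => x i + c :=
  ⟨fun i => add_nonneg (hx.1 i) hc, fun i j hij => by linarith [hx.2 i j hij]⟩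

theorem InBudget.nonneg {V : Type*} [DecidableEq V] {J : Finset V} {δhat δ : V → ℝ} {Γ : ℕ}
    (hδ : InBudget J δhat Γ δ) (hδhat : ∀ i, 0 ≤ δhat i) (i : V) : 0 ≤ δ i := by
  obtain ⟨S, -, -, hS, hS'⟩ := hδ
  by_cases hi : i ∈ S
  · exact (hδhat i).trans_eq (hS i hi).symm
  · exact (hS' i hi).ge

theorem inBudget_zero {V : Type*} [DecidableEq V] (J : Finset V) (δhat : V → ℝ) (Γ : ℕ) :
    InBudget J δhat Γ fun _ => 0 :=
  ⟨∅, by simp, by simp, by simp, by simp⟩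

/-- For acyclic `(V, E)` and a deadline `M`, there exists a schedule `z` of `(V, E, p)`
with `z t ≤ M` such that `{t}` is anchored w.r.t. `z`, if and only if `M ≥ Q_Γ(E)`. -/
theorem anchored_t_deadline_iff_ge_worst_case {V : Type*} [Fintype V] [DecidableEq V]
    (J : Finset V) (s t : V) (hst : s ≠ t) (hsJ : s ∉ J) (htJ : t ∉ J)
    (hV : ∀ v : V, v ∈ J ∨ v = s ∨ v = t)
    (p : V → ℝ) (hp : ∀ i, 0 ≤ p i) (hps : p s = 0) (hpt : p t = 0)
    (δhat : V → ℝ) (hδhat : ∀ i, 0 ≤ δhat i) (hδs : δhat s = 0) (hδt : δhat t = 0)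
    (Γ : ℕ)
    (E : Set (V × V)) (hE : Acyclic E) (M : ℝ)
    (Q : ℝ) (hQ : IsGreatest (WorstCaseSet J δhat Γ E p t) Q) :
    (∃ z : V → ℝ, Schedule E p z ∧ z t ≤ M ∧ Anchored J δhat Γ E p z {t}) ↔ Q ≤ M := by
  constructor
  · rintro ⟨z, -, hzM, hz⟩
    obtain ⟨δ, hδ, hleast⟩ := hQ.1
    obtain ⟨zd, hzd, heq⟩ := hz δ hδ
    exact (hleast.2 ⟨zd, hzd, heq t rfl⟩).trans hzM
  · intro hQM
    have key : ∀ δ, InBudget J δhat Γ δ →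
        ∃ x, Schedule E (fun i => p i + δ i) x ∧ x t = Q := by
      intro δ hδ
      obtain ⟨e, hes, hemin⟩ := hE.exists_earliest_schedule
        (q := fun i => p i + δ i) fun i => add_nonneg (hp i) (hδ.nonneg hδhat i)
      have heQ : e t ≤ Q := hQ.2 ⟨δ, hδ, ⟨e, hes, rfl⟩, by
        rintro _ ⟨x, hx, rfl⟩
        exact hemin x hx t⟩
      exact ⟨_, hes.add_const (sub_nonneg.2 heQ), by ring⟩
    obtain ⟨z, hz, hzt⟩ := key _ (inBudget_zero J δhat Γ)
    refine ⟨z, by simpa using hz, hzt.trans_le hQM, fun δ hδ => ?_⟩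
    obtain ⟨x, hx, hxt⟩ := key δ hδ
    refine ⟨x, hx, ?_⟩
    rintro _ rfl
    rw [hxt, hzt]
end
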